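/- arXiv:1608.02155 — 2 statements merged into one kernel-verified Lean document; each statement's English description precedes it below -/
import Mathlib

section
/- Let φ ∈ K(z) have degree d ≥ 2, let [F,G] be a normalized homogeneous lift of φ, and suppose the reduction φ_v does not lie in the indeterminacy locus I(d). Then for every n ≥ 1 the n-fold iterated lift [F_n, G_n] (where F_{n+1} = F(F_n,G_n), G_{n+1} = G(F_n,G_n)) is itself a normalized lift of φⁿ; that is, every coefficient of F_n and G_n lies in O and at least one coefficient has absolute value 1. In particular the coefficientwise reduction of [F_n, G_n] modulo m is not identically zero, and it equals the pair of binary forms over k obtained by n-fold iteration of the reduced pair [F̃, G̃]. -/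
open MvPolynomial Matrix

noncomputable section

variable {R : Type*} [CommRing R]

def coeffVec (e : ℕ) (F : MvPolynomial (Fin 2) R) (i : Fin (e + 1)) : R :=
  MvPolynomial.coeff (Finsupp.single 0 (e - (i : ℕ)) + Finsupp.single 1 (i : ℕ)) F

def sylv (e : ℕ) (a b : Fin (e + 1) → R) : Matrix (Fin (e + e)) (Fin (e + e)) R :=
  Matrix.of fun i j =>
    if h : (i : ℕ) < e then
      if hj : (i : ℕ) ≤ (j : ℕ) ∧ (j : ℕ) ≤ (i : ℕ) + e then
        a ⟨(j : ℕ) - (i : ℕ), by omega⟩ else 0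
    else
      if hj : (i : ℕ) - e ≤ (j : ℕ) ∧ (j : ℕ) ≤ (i : ℕ) then
        b ⟨(j : ℕ) - ((i : ℕ) - e), by omega⟩ else 0

def bres (e : ℕ) (F G : MvPolynomial (Fin 2) R) : R :=
  (sylv e (coeffVec e F) (coeffVec e G)).det

def comp2 (F f g : MvPolynomial (Fin 2) R) : MvPolynomial (Fin 2) R :=
  MvPolynomial.aeval ![f, g] F

def pairIter (F G : MvPolynomial (Fin 2) R) : ℕ → MvPolynomial (Fin 2) R × MvPolynomial (Fin 2) R
  | 0 => (X 0, X 1)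
  | n + 1 => (comp2 F (pairIter F G n).1 (pairIter F G n).2,
              comp2 G (pairIter F G n).1 (pairIter F G n).2)

variable (K : Type) [NontriviallyNormedField K] [IsUltrametricDist K]

def ordv (x : K) : ℝ := -Real.log ‖x‖

def intRing : Subring K where
  carrier := {x : K | ‖x‖ ≤ 1}
  one_mem' := by simp
  zero_mem' := by simp
  mul_mem' := by
    intro a b ha hb
    simp only [Set.mem_setOf_eq] at *
    calc ‖a * b‖ = ‖a‖ * ‖b‖ := norm_mul a b
    _ ≤ 1 * 1 := by gcongr
    _ = 1 := by ring
  add_mem' := by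
    intro a b ha hb
    simp only [Set.mem_setOf_eq] at *
    exact (IsUltrametricDist.norm_add_le_max a b).trans (max_le ha hb)
  neg_mem' := by
    intro a ha
    simp only [Set.mem_setOf_eq, norm_neg] at *
    exact ha

def maxIdl : Ideal (intRing K) where
  carrier := {x | ‖(x : K)‖ < 1}
  zero_mem' := by simp
  add_mem' := by
    intro a b ha hb
    simp only [Set.mem_setOf_eq] at *
    exact lt_of_le_of_lt (IsUltrametricDist.norm_add_le_max (a : K) b) (max_lt ha hb)
  smul_mem' := by
    intro c x hx
    simp only [Set.mem_setOf_eq] at *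
    calc ‖((c • x : intRing K) : K)‖ = ‖(c : K)‖ * ‖(x : K)‖ := norm_mul _ _
    _ ≤ 1 * ‖(x : K)‖ := by gcongr; exact c.2
    _ < 1 := by simpa using hx

def kk := intRing K ⧸ maxIdl K

instance : CommRing (kk K) := Ideal.Quotient.commRing (maxIdl K)

def redCoeff (x : K) : kk K :=
  if h : ‖x‖ ≤ 1 then Ideal.Quotient.mk (maxIdl K) ⟨x, h⟩ else 0

def redPoly (F : MvPolynomial (Fin 2) K) : MvPolynomial (Fin 2) (kk K) :=
  ∑ m ∈ F.support, MvPolynomial.monomial m (redCoeff K (F.coeff m))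

/-- A pair of binary forms is a (homogeneous) lift of a degree-`d` rational map if both entries
are homogeneous of degree `d` and they are coprime. -/
def LiftPair (d : ℕ) (F G : MvPolynomial (Fin 2) K) : Prop :=
  F.IsHomogeneous d ∧ G.IsHomogeneous d ∧ IsRelPrime F G

/-- A pair of binary forms is normalized if all coefficients lie in `O`
and some coefficient has absolute value `1`. -/
def Normalized (F G : MvPolynomial (Fin 2) K) : Prop :=
  (∀ m, ‖F.coeff m‖ ≤ 1) ∧ (∀ m, ‖G.coeff m‖ ≤ 1) ∧
    (∃ m, ‖F.coeff m‖ = 1 ∨ ‖G.coeff m‖ = 1)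

/-- The maximum of the absolute values of the coefficients of a pair of degree-`e` binary forms. -/
def maxNorm (e : ℕ) (F G : MvPolynomial (Fin 2) K) : ℝ :=
  Finset.univ.sup' Finset.univ_nonempty
    (fun i : Fin (e + 1) => max ‖coeffVec e F i‖ ‖coeffVec e G i‖)

/-- `Rpair e F G` is the quantity `R_φ = ord(Res(F₀,G₀))` where `(F₀,G₀)` is the normalized
rescaling of the pair `(F,G)` of degree-`e` binary forms; equivalently it is
`ord(Res(F,G)) - 2·e·(minimal ord of a coefficient of F, G)`. -/
def Rpair (e : ℕ) (F G : MvPolynomial (Fin 2) K) : ℝ :=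
  ordv K (bres e F G) + 2 * e * Real.log (maxNorm K e F G)

/-- Linear substitution of a `2×2` matrix into a binary form. -/
def mobius (M : Matrix (Fin 2) (Fin 2) K) (F : MvPolynomial (Fin 2) K) :
    MvPolynomial (Fin 2) K :=
  MvPolynomial.aeval
    ![C (M 0 0) * X 0 + C (M 0 1) * X 1, C (M 1 0) * X 0 + C (M 1 1) * X 1] F

/-- The conjugate pair `γ⁻¹ ∘ (F,G) ∘ γ`, a homogeneous lift of `φ^γ = γ⁻¹ ∘ φ ∘ γ`. -/
def conjPair (M : GL (Fin 2) K) (F G : MvPolynomial (Fin 2) K) :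
    MvPolynomial (Fin 2) K × MvPolynomial (Fin 2) K :=
  (C ((M⁻¹ : GL (Fin 2) K) 0 0) * mobius K M F + C ((M⁻¹ : GL (Fin 2) K) 0 1) * mobius K M G,
   C ((M⁻¹ : GL (Fin 2) K) 1 0) * mobius K M F + C ((M⁻¹ : GL (Fin 2) K) 1 1) * mobius K M G)

/-- The minimal resultant `R_{[φ]} = inf_γ R_{φ^γ}` of (the map lifted by) a degree-`e` pair. -/
def Rmin (e : ℕ) (F G : MvPolynomial (Fin 2) K) : ℝ :=
  ⨅ M : GL (Fin 2) K, Rpair K e (conjPair K M F G).1 (conjPair K M F G).2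

/-- `Ilocus d F G` says the reduction of the normalized pair `(F,G)` lies in the indeterminacy
locus `I(d)`: the reduced pair is proportional, i.e. `(F̃, G̃) = (a·C, b·C)` with `[a:b] ∈ P¹(k)`
(so that the residue map is the constant `[a:b]`), and the constant value `[a:b]`
is a root of the common factor `C` (which is the gcd `Ã` of `F̃` and `G̃`). -/
def Ilocus (d : ℕ) (F G : MvPolynomial (Fin 2) K) : Prop :=
  ∃ (a b : kk K) (Cf : MvPolynomial (Fin 2) (kk K)),
    ¬(a = 0 ∧ b = 0) ∧ Cf.IsHomogeneous d ∧
    redPoly K F = MvPolynomial.C a * Cf ∧ redPoly K G = MvPolynomial.C b * Cf ∧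
    MvPolynomial.eval ![a, b] Cf = 0

/-- `Semistable d F G` says the reduction of the normalized pair `(F,G)` is GIT-semistable
(Silverman's numerical criterion): writing `F̃ = Ã·F̃₀`, `G̃ = Ã·G̃₀` with `F̃₀, G̃₀` coprime,
every root `h = [a:b]` of `Ã` has multiplicity `r ≤ d/2` (`d` even), resp. `r ≤ (d+1)/2`
(`d` odd), and when the bound is attained additionally `φ̃(h) ≠ h`. -/
def Semistable (d : ℕ) (F G : MvPolynomial (Fin 2) K) : Prop :=
  ∃ (A F0 G0 : MvPolynomial (Fin 2) (kk K)) (e : ℕ),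
    e ≤ d ∧ A.IsHomogeneous (d - e) ∧ F0.IsHomogeneous e ∧ G0.IsHomogeneous e ∧
    redPoly K F = A * F0 ∧ redPoly K G = A * G0 ∧ IsRelPrime F0 G0 ∧
    ∀ (a b : kk K), ¬(a = 0 ∧ b = 0) → ∀ r : ℕ,
      (MvPolynomial.C b * X 0 - MvPolynomial.C a * X 1) ^ r ∣ A →
        2 * r ≤ d + 1 ∧
          (d ≤ 2 * r →
            b * MvPolynomial.eval ![a, b] F0 ≠ a * MvPolynomial.eval ![a, b] G0)

/-- The rational map lifted by the (not necessarily normalized) pair `(F,G)` has semistable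
reduction: some normalized rescaling is `Semistable`. -/
def HasSemistableRed (d : ℕ) (F G : MvPolynomial (Fin 2) K) : Prop :=
  ∃ c : Kˣ, Normalized K ((c : K) • F) ((c : K) • G) ∧
    Semistable K d ((c : K) • F) ((c : K) • G)

/-- The reduction of (a normalized rescaling of) the pair `(F,G)` lies outside `I(d)`. -/
def RedOutsideI (d : ℕ) (F G : MvPolynomial (Fin 2) K) : Prop :=
  ∃ c : Kˣ, Normalized K ((c : K) • F) ((c : K) • G) ∧
    ¬ Ilocus K d ((c : K) • F) ((c : K) • G)

/-- The `m`-th term (`m ≥ 1`) of Tate's series `x(w)`. -/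
def tateTerm (q w : K) (m : ℕ) : K :=
  q ^ m * w / (1 - q ^ m * w) ^ 2 + q ^ m * w⁻¹ / (1 - q ^ m * w⁻¹) ^ 2
    - 2 * (q ^ m / (1 - q ^ m) ^ 2)

/-- Tate's series `x(w)` for the Tate curve with parameter `q`. -/
def xTate (q w : K) : K :=
  w / (1 - w) ^ 2 + ∑' m : ℕ, tateTerm K q w (m + 1)

section BinaryForms

variable {k A : Type*} [Field k] [CommRing A] [Algebra k A]

theorem aeval_mul_of_isHomogeneous {H : MvPolynomial (Fin 2) k} {d : ℕ} (hH : H.IsHomogeneous d)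
    (w x y : A) : aeval ![w * x, w * y] H = w ^ d * aeval ![x, y] H := by
  simp only [aeval_def, eval₂_eq', Finset.mul_sum]
  refine Finset.sum_congr rfl fun m hm => ?_
  have hd : m 0 + m 1 = d := by
    simpa [Finsupp.weight_apply, Finsupp.sum_fintype] using hH (mem_support_iff.mp hm)
  simp only [Fin.prod_univ_two, Matrix.cons_val_zero, Matrix.cons_val_one, ← hd]
  ring

theorem aeval_algebraMap_pair (H : MvPolynomial (Fin 2) k) (a b : k) :
    aeval ![algebraMap k A a, algebraMap k A b] H = algebraMap k A (eval ![a, b] H) := by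
  have : ![algebraMap k A a, algebraMap k A b] = algebraMap k A ∘ ![a, b] := by
    ext i; fin_cases i <;> rfl
  rw [this, aeval_algebraMap_apply, aeval_eq_eval]

theorem aeval_proportional {H : MvPolynomial (Fin 2) k} {d : ℕ} (hH : H.IsHomogeneous d)
    (w : A) (a b : k) :
    aeval ![w * algebraMap k A a, w * algebraMap k A b] H
      = w ^ d * algebraMap k A (eval ![a, b] H) := by
  rw [aeval_mul_of_isHomogeneous hH, aeval_algebraMap_pair]

theorem eq_zero_of_dehomogenization_eq_zero [Infinite k] {H : MvPolynomial (Fin 2) k} {d : ℕ}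
    (hH : H.IsHomogeneous d)
    (h0 : aeval ![(Polynomial.X : Polynomial k), 1] H = 0) : H = 0 := by
  have hmul : X 1 * H = 0 := by
    refine MvPolynomial.funext fun x => ?_
    rw [map_mul, eval_X, map_zero]
    rcases eq_or_ne (x 1) 0 with hx | hx
    · rw [hx, zero_mul]
    · have hx' : x = ![x 1 * (x 0 / x 1), x 1 * 1] := by
        ext i; fin_cases i
        · simp [mul_div_cancel₀ _ hx]
        · simp
      have h1 := congrArg (Polynomial.aeval (x 0 / x 1)) h0
      rw [map_zero, ← AlgHom.comp_apply, comp_aeval] at h1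
      have h2 : (fun i => Polynomial.aeval (x 0 / x 1) (![(Polynomial.X : Polynomial k), 1] i))
          = ![x 0 / x 1, 1] := by
        ext i; fin_cases i <;> simp
      rw [h2] at h1
      have h3 := aeval_mul_of_isHomogeneous hH (x 1) (x 0 / x 1) 1
      rw [← hx', h1, mul_zero, aeval_eq_eval] at h3
      rw [h3, mul_zero]
  exact (mul_eq_zero.mp hmul).resolve_left (X_ne_zero 1)

/-- A zero in a domain of a nonzero binary form over an algebraically closed field is
proportional to a rational point of the projective line. -/
theorem exists_proportional_of_aeval_eq_zero [IsAlgClosed k] [IsDomain A]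
    {H : MvPolynomial (Fin 2) k} {d : ℕ} (hH : H.IsHomogeneous d) (h0 : H ≠ 0) {u v : A}
    (huv : aeval ![u, v] H = 0) :
    ∃ a b : k, ¬(a = 0 ∧ b = 0) ∧ ∃ w : A, u = w * algebraMap k A a ∧ v = w * algebraMap k A b := by
  rcases eq_or_ne v 0 with hv | hv
  · exact ⟨1, 0, by simp, u, by simp, by simp [hv]⟩
  let L := FractionRing A
  have hvL : algebraMap A L v ≠ 0 := by simpa using hv
  have hinf : Infinite k := IsAlgClosed.instInfinite
  set p := aeval ![(Polynomial.X : Polynomial k), 1] H with hp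
  have hp0 : p ≠ 0 := fun h => h0 (eq_zero_of_dehomogenization_eq_zero hH h)
  set x : L := algebraMap A L u / algebraMap A L v with hx
  have hroot : Polynomial.aeval x p = 0 := by
    have h1 := congrArg (IsScalarTower.toAlgHom k A L) huv
    rw [map_zero, ← AlgHom.comp_apply, comp_aeval] at h1
    have h2 : (fun i => IsScalarTower.toAlgHom k A L (![u, v] i))
        = ![algebraMap A L v * x, algebraMap A L v * 1] := by
      ext i; fin_cases i
      · simp [hx, mul_div_cancel₀ _ hvL]
      · simp
    rw [h2, aeval_mul_of_isHomogeneous hH] at h1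
    have h3 := (mul_eq_zero.mp h1).resolve_left (pow_ne_zero _ hvL)
    rw [hp, ← AlgHom.comp_apply, comp_aeval, ← h3]
    congr 2
    ext i; fin_cases i <;> simp
  have hmem : x ∈ (algebraMap k L).range := by
    have hs := IsAlgClosed.splits p
    exact hs.mem_range_of_isRoot hp0 (by simpa using hroot)
  obtain ⟨c, hc⟩ := hmem
  refine ⟨c, 1, by simp, v, ?_, by simp⟩
  apply IsFractionRing.injective A L
  rw [map_mul, ← IsScalarTower.algebraMap_apply, hc, hx, mul_div_cancel₀ _ hvL]

theorem linear_dvd_of_eval_eq_zero {H : MvPolynomial (Fin 2) k} {d : ℕ} (hH : H.IsHomogeneous d)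
    {a b : k} (hab : ¬(a = 0 ∧ b = 0)) (h0 : eval ![a, b] H = 0) :
    C b * X 0 - C a * X 1 ∣ H := by
  rw [← Ideal.mem_span_singleton, ← Ideal.Quotient.eq_zero_iff_mem]
  set I := Ideal.span {(C b * X 0 - C a * X 1 : MvPolynomial (Fin 2) k)}
  let B := MvPolynomial (Fin 2) k ⧸ I
  let q : MvPolynomial (Fin 2) k →ₐ[k] B := Ideal.Quotient.mkₐ k I
  have hrel : algebraMap k B b * q (X 0) = algebraMap k B a * q (X 1) := by
    have : q (C b * X 0 - C a * X 1) = 0 :=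
      Ideal.Quotient.eq_zero_iff_mem.mpr (Ideal.subset_span rfl)
    rw [map_sub, map_mul, map_mul, ← algebraMap_eq, AlgHom.commutes, AlgHom.commutes] at this
    exact sub_eq_zero.mp this
  have hw : ∃ w : B, q (X 0) = w * algebraMap k B a ∧ q (X 1) = w * algebraMap k B b := by
    rcases eq_or_ne a 0 with ha | ha
    · have hb : b ≠ 0 := fun hb => hab ⟨ha, hb⟩
      have hb' : algebraMap k B b⁻¹ * algebraMap k B b = 1 := by
        rw [← map_mul, inv_mul_cancel₀ hb, map_one]
      exact ⟨q (X 1) * algebraMap k B b⁻¹,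
        by linear_combination algebraMap k B b⁻¹ * hrel - q (X 0) * hb',
        by linear_combination -q (X 1) * hb'⟩
    · have ha' : algebraMap k B a⁻¹ * algebraMap k B a = 1 := by
        rw [← map_mul, inv_mul_cancel₀ ha, map_one]
      exact ⟨q (X 0) * algebraMap k B a⁻¹,
        by linear_combination -q (X 0) * ha',
        by linear_combination -algebraMap k B a⁻¹ * hrel - q (X 1) * ha'⟩
  obtain ⟨w, hw0, hw1⟩ := hw
  have hq : q H = aeval ![q (X 0), q (X 1)] H := by
    have : q = aeval ![q (X 0), q (X 1)] := by
      apply algHom_ext; intro i; fin_cases i <;> simp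
    exact DFunLike.congr_fun this H
  change q H = 0
  rw [hq, hw0, hw1, aeval_proportional hH, h0, map_zero, mul_zero]

theorem not_isUnit_linear (a b : k) :
    ¬IsUnit (C b * X 0 - C a * X 1 : MvPolynomial (Fin 2) k) := by
  intro h
  simpa using h.map (eval (0 : Fin 2 → k))

theorem eval_ne_zero_of_isRelPrime {F G : MvPolynomial (Fin 2) k} {d : ℕ}
    (hF : F.IsHomogeneous d) (hG : G.IsHomogeneous d) (hFG : IsRelPrime F G) {a b : k}
    (hab : ¬(a = 0 ∧ b = 0)) : ¬(eval ![a, b] F = 0 ∧ eval ![a, b] G = 0) := fun h =>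
  not_isUnit_linear a b
    (hFG (linear_dvd_of_eval_eq_zero hF hab h.1) (linear_dvd_of_eval_eq_zero hG hab h.2))

theorem eq_zero_of_aeval_eq_zero_of_isRelPrime [IsAlgClosed k] [IsDomain A]
    {F G : MvPolynomial (Fin 2) k} {d : ℕ} (hF : F.IsHomogeneous d) (hG : G.IsHomogeneous d)
    (hFG : IsRelPrime F G) {u v : A} (hFuv : aeval ![u, v] F = 0) (hGuv : aeval ![u, v] G = 0)
    (h0 : ¬(F = 0 ∧ G = 0)) : u = 0 ∧ v = 0 := by
  have hprop : ∃ a b : k, ¬(a = 0 ∧ b = 0) ∧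
      ∃ w : A, u = w * algebraMap k A a ∧ v = w * algebraMap k A b := by
    by_cases hF0 : F = 0
    · exact exists_proportional_of_aeval_eq_zero hG (fun hG0 => h0 ⟨hF0, hG0⟩) hGuv
    · exact exists_proportional_of_aeval_eq_zero hF hF0 hFuv
  obtain ⟨a, b, hab, w, rfl, rfl⟩ := hprop
  rw [aeval_proportional ‹_›] at hFuv hGuv
  have hw : w = 0 := by
    by_contra hw
    refine eval_ne_zero_of_isRelPrime hF hG hFG hab ⟨?_, ?_⟩
    · simpa [hw] using hFuv
    · simpa [hw] using hGuv
  simp [hw]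

theorem isRelPrime_comp2 [IsAlgClosed k] {F G u v : MvPolynomial (Fin 2) k} {d : ℕ}
    (hF : F.IsHomogeneous d) (hG : G.IsHomogeneous d) (hFG : IsRelPrime F G)
    (huv : IsRelPrime u v) : IsRelPrime (comp2 F u v) (comp2 G u v) := by
  have h0 : ¬(F = 0 ∧ G = 0) := by
    rintro ⟨rfl, rfl⟩
    exact not_isUnit_zero (hFG (dvd_refl 0) (dvd_refl 0))
  have key : ∀ q : MvPolynomial (Fin 2) k, Prime q → q ∣ comp2 F u v → ¬q ∣ comp2 G u v := by
    intro q hq hqF hqG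
    let I := Ideal.span {q}
    have hI : I.IsPrime := (Ideal.span_singleton_prime hq.ne_zero).mpr hq
    let π : MvPolynomial (Fin 2) k →ₐ[k] MvPolynomial (Fin 2) k ⧸ I := Ideal.Quotient.mkₐ k I
    have hπ : ∀ x, π x = 0 ↔ q ∣ x := fun x =>
      Ideal.Quotient.eq_zero_iff_mem.trans Ideal.mem_span_singleton
    have hcomp : ∀ H, π (comp2 H u v) = aeval ![π u, π v] H := by
      intro H
      rw [comp2, ← AlgHom.comp_apply, comp_aeval]
      congr 2
      ext i; fin_cases i <;> rfl
    have := eq_zero_of_aeval_eq_zero_of_isRelPrime hF hG hFG (u := π u) (v := π v)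
      (by rw [← hcomp, hπ]; exact hqF) (by rw [← hcomp, hπ]; exact hqG) h0
    exact hq.not_isUnit (huv ((hπ u).mp this.1) ((hπ v).mp this.2))
  refine WfDvdMonoid.isRelPrime_of_no_irreducible_factors ?_ fun q hq => key q hq.prime
  rintro ⟨h1, h2⟩
  exact key (X 0) X_prime (h1 ▸ dvd_zero _) (h2 ▸ dvd_zero _)

theorem isHomogeneous_pairIter {S : Type*} [CommRing S] {F G : MvPolynomial (Fin 2) S} {d : ℕ}
    (hF : F.IsHomogeneous d) (hG : G.IsHomogeneous d) (n : ℕ) :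
    (pairIter F G n).1.IsHomogeneous (d ^ n) ∧ (pairIter F G n).2.IsHomogeneous (d ^ n) := by
  induction n with
  | zero => exact ⟨by simpa [pairIter] using isHomogeneous_X S (0 : Fin 2),
      by simpa [pairIter] using isHomogeneous_X S (1 : Fin 2)⟩
  | succ n ih =>
    have hg : ∀ i, (![(pairIter F G n).1, (pairIter F G n).2] i).IsHomogeneous (d ^ n) := by
      intro i; fin_cases i
      · exact ih.1
      · exact ih.2
    rw [pow_succ]
    exact ⟨hF.aeval _ hg, hG.aeval _ hg⟩

theorem isRelPrime_pairIter [IsAlgClosed k] {F G : MvPolynomial (Fin 2) k} {d : ℕ}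
    (hF : F.IsHomogeneous d) (hG : G.IsHomogeneous d) (hFG : IsRelPrime F G) (n : ℕ) :
    IsRelPrime (pairIter F G n).1 (pairIter F G n).2 := by
  induction n with
  | zero =>
    refine ((X_prime (i := 0)).irreducible.isRelPrime_iff_not_dvd).mpr fun h => ?_
    simp [pairIter, X_dvd_X] at h
  | succ n ih => exact isRelPrime_comp2 hF hG hFG ih

/-- If the components of a pair are linearly independent, so are those of its iterates. -/
theorem pairIter_ne_of_linearIndependent [IsAlgClosed k] {F G : MvPolynomial (Fin 2) k} {d : ℕ}
    (hF : F.IsHomogeneous d) (hG : G.IsHomogeneous d)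
    (hlin : ∀ a b : k, C a * F + C b * G = 0 → a = 0 ∧ b = 0) (n : ℕ) (a b : k)
    (h : C a * (pairIter F G n).1 + C b * (pairIter F G n).2 = 0) : a = 0 ∧ b = 0 := by
  induction n generalizing a b with
  | zero =>
    constructor
    · simpa [pairIter] using congrArg (eval ![1, 0]) h
    · simpa [pairIter] using congrArg (eval ![0, 1]) h
  | succ n ih =>
    by_contra hab
    have hH : (C a * F + C b * G).IsHomogeneous d := by
      simpa using ((isHomogeneous_C _ a).mul hF).add ((isHomogeneous_C _ b).mul hG)
    obtain ⟨s, t, hst, w, hs, ht⟩ := exists_proportional_of_aeval_eq_zero hH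
      (fun h0 => hab (hlin a b h0)) (u := (pairIter F G n).1) (v := (pairIter F G n).2)
      (by rw [map_add, map_mul, map_mul, algHom_C, algHom_C]; exact h)
    have := ih t (-s) (by rw [hs, ht, algebraMap_eq, C_neg]; ring)
    exact hst ⟨neg_eq_zero.mp this.2, this.1⟩

theorem pairIter_proportional {F G H : MvPolynomial (Fin 2) k} {d : ℕ}
    (hH : H.IsHomogeneous d) {a b : k} (hF : F = C a * H) (hG : G = C b * H)
    (h0 : eval ![a, b] H ≠ 0) (n : ℕ) :
    ∃ w, w ≠ 0 ∧ (pairIter F G (n + 1)).1 = w * C a ∧ (pairIter F G (n + 1)).2 = w * C b := by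
  have hstep : ∀ u v, comp2 F u v = comp2 H u v * C a ∧ comp2 G u v = comp2 H u v * C b := by
    intro u v
    simp [comp2, hF, hG, algHom_C, mul_comm]
  induction n with
  | zero =>
    refine ⟨comp2 H (X 0) (X 1), ?_, (hstep _ _).1, (hstep _ _).2⟩
    have : ![(X 0 : MvPolynomial (Fin 2) k), X 1] = X := by ext1 i; fin_cases i <;> rfl
    rw [comp2, this, aeval_X_left_apply]
    rintro rfl
    simp at h0
  | succ n ih =>
    obtain ⟨w, hw, h1, h2⟩ := ih
    refine ⟨_, ?_, (hstep _ _).1, (hstep _ _).2⟩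
    rw [comp2, h1, h2, ← algebraMap_eq, aeval_proportional hH]
    exact mul_ne_zero (pow_ne_zero _ hw) (by simpa [algebraMap_eq] using h0)

/-- A nonzero pair of binary forms outside the indeterminacy locus has nonzero iterates. -/
theorem pairIter_ne_zero [IsAlgClosed k] {F G : MvPolynomial (Fin 2) k} {d : ℕ}
    (hF : F.IsHomogeneous d) (hG : G.IsHomogeneous d)
    (hI : ∀ (a b : k) (H : MvPolynomial (Fin 2) k), ¬(a = 0 ∧ b = 0) → H.IsHomogeneous d →
      F = C a * H → G = C b * H → eval ![a, b] H ≠ 0) (n : ℕ) :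
    ¬((pairIter F G n).1 = 0 ∧ (pairIter F G n).2 = 0) := by
  rintro ⟨h1, h2⟩
  by_cases hlin : ∀ a b : k, C a * F + C b * G = 0 → a = 0 ∧ b = 0
  · have := pairIter_ne_of_linearIndependent hF hG hlin n 1 0 (by simp [h1, h2])
    exact one_ne_zero this.1
  push Not at hlin
  obtain ⟨a, b, hrel, hab⟩ := hlin
  have hprop : ∃ (s t : k) (H : MvPolynomial (Fin 2) k), ¬(s = 0 ∧ t = 0) ∧ H.IsHomogeneous d ∧
      F = C s * H ∧ G = C t * H := by
    rcases eq_or_ne a 0 with ha | ha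
    · have hb : C b⁻¹ * C b = (1 : MvPolynomial (Fin 2) k) := by
        rw [← C_mul, inv_mul_cancel₀ (hab ha), C_1]
      refine ⟨1, 0, F, by simp, hF, by simp, ?_⟩
      rw [ha, C_0] at hrel
      rw [C_0]
      linear_combination C b⁻¹ * hrel - G * hb
    · have ha' : C a⁻¹ * C a = (1 : MvPolynomial (Fin 2) k) := by
        rw [← C_mul, inv_mul_cancel₀ ha, C_1]
      refine ⟨-b, a, C a⁻¹ * G, fun h => ha h.2, by
        simpa using (isHomogeneous_C _ a⁻¹).mul hG, ?_, ?_⟩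
      · rw [C_neg]
        linear_combination C a⁻¹ * hrel - F * ha'
      · linear_combination - G * ha'
  obtain ⟨s, t, H, hst, hH, rfl, rfl⟩ := hprop
  cases n with
  | zero => exact X_ne_zero 0 h1
  | succ n =>
    obtain ⟨w, hw, hw1, hw2⟩ := pairIter_proportional hH rfl rfl (hI s t H hst hH rfl rfl) n
    rw [hw1] at h1
    rw [hw2] at h2
    exact hst ⟨by simpa [hw] using h1, by simpa [hw] using h2⟩

end BinaryForms

theorem map_comp2 {S T : Type*} [CommRing S] [CommRing T] (f : S →+* T)
    (F u v : MvPolynomial (Fin 2) S) :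
    map f (comp2 F u v) = comp2 (map f F) (map f u) (map f v) := by
  induction F using MvPolynomial.induction_on with
  | C a => simp [comp2, algHom_C]
  | add p q hp hq => simp only [comp2, map_add] at *; rw [hp, hq]
  | mul_X p i hp =>
    simp only [comp2, map_mul, aeval_X, map_X] at *
    rw [hp]
    fin_cases i <;> rfl

theorem map_pairIter {S T : Type*} [CommRing S] [CommRing T] (f : S →+* T)
    (F G : MvPolynomial (Fin 2) S) (n : ℕ) :
    map f (pairIter F G n).1 = (pairIter (map f F) (map f G) n).1 ∧
      map f (pairIter F G n).2 = (pairIter (map f F) (map f G) n).2 := by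
  induction n with
  | zero => simp [pairIter]
  | succ n ih => simp only [pairIter, map_comp2, ih, and_self]

section Reduction

variable {E : Type} [NontriviallyNormedField E] [IsUltrametricDist E]

variable (E) in
/-- The reduction homomorphism from the ring of integers to the residue field. -/
def residueHom : intRing E →+* kk E := Ideal.Quotient.mk (maxIdl E)

theorem residueHom_surjective : Function.Surjective (residueHom E) :=
  Ideal.Quotient.mk_surjective

theorem residueHom_eq_zero_iff {x : intRing E} : residueHom E x = 0 ↔ ‖(x : E)‖ < 1 :=
  Ideal.Quotient.eq_zero_iff_mem

variable (E) in
/-- The ring of integers as a valuation subring. -/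
def intValuationSubring : ValuationSubring E where
  __ := intRing E
  mem_or_inv_mem' x := by
    change ‖x‖ ≤ 1 ∨ ‖x⁻¹‖ ≤ 1
    rw [norm_inv]
    exact (le_total ‖x‖ 1).imp_right inv_le_one_of_one_le₀

theorem norm_le_one_of_isIntegral {x : E} (hx : IsIntegral (intRing E) x) : ‖x‖ ≤ 1 := by
  have hx' : IsIntegral (intValuationSubring E) x := hx
  obtain ⟨y, rfl⟩ := IsIntegrallyClosed.isIntegral_iff.mp hx'
  exact y.2

theorem isField_kk : IsField (kk E) where
  exists_pair_ne := ⟨0, 1, fun h => by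
    have : residueHom E 1 = 0 := by rw [map_one, h]
    rw [residueHom_eq_zero_iff] at this
    simp at this⟩
  mul_comm := mul_comm
  mul_inv_cancel := by
    intro a ha
    obtain ⟨x, rfl⟩ := residueHom_surjective a
    rw [Ne, residueHom_eq_zero_iff, not_lt] at ha
    have hx : (x : E) ≠ 0 := by
      intro h
      rw [h, norm_zero] at ha
      linarith
    let y : intRing E := ⟨(x : E)⁻¹, by
      change ‖(x : E)⁻¹‖ ≤ 1
      rw [norm_inv]
      exact inv_le_one_of_one_le₀ ha⟩
    refine ⟨residueHom E y, ?_⟩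
    rw [← map_mul, ← map_one (residueHom E)]
    congr 1
    exact Subtype.ext (mul_inv_cancel₀ hx)

instance : Field (kk E) where
  __ := isField_kk.toField
  __ := (inferInstance : CommRing (kk E))

instance [IsAlgClosed E] : IsAlgClosed (kk E) := by
  refine IsAlgClosed.of_exists_root _ fun p hp hirr => ?_
  obtain ⟨q, hq, hdeg, hmonic⟩ := Polynomial.lifts_and_degree_eq_and_monic
    (f := residueHom E) ((Polynomial.mem_lifts p).mpr
      (Polynomial.map_surjective _ residueHom_surjective p)) hp
  obtain ⟨x, hx⟩ := IsAlgClosed.exists_eval₂_eq_zero_of_injective (intRing E).subtype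
    Subtype.val_injective q (by rw [hdeg]; exact (Polynomial.degree_pos_of_irreducible hirr).ne')
  let y : intRing E := ⟨x, norm_le_one_of_isIntegral ⟨q, hmonic, hx⟩⟩
  have hy : q.eval y = 0 := by
    apply Subtype.val_injective (p := (· ∈ intRing E))
    exact (Polynomial.hom_eval₂ q (RingHom.id _) (intRing E).subtype y).trans hx
  refine ⟨residueHom E y, ?_⟩
  rw [← hq, Polynomial.eval_map_apply, hy, map_zero]

theorem exists_map_subtype_eq {F : MvPolynomial (Fin 2) E} (hF : ∀ m, ‖F.coeff m‖ ≤ 1) :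
    ∃ P : MvPolynomial (Fin 2) (intRing E), map (intRing E).subtype P = F := by
  refine mem_range_map_iff_coeffs_subset.mpr ?_
  intro c hc
  obtain ⟨m, -, rfl⟩ := mem_coeffs_iff.mp hc
  exact ⟨⟨F.coeff m, hF m⟩, rfl⟩

theorem redPoly_map_subtype (P : MvPolynomial (Fin 2) (intRing E)) :
    redPoly E (map (intRing E).subtype P) = map (residueHom E) P := by
  have hred : ∀ x : intRing E, redCoeff E ((intRing E).subtype x) = residueHom E x :=
    fun x => dif_pos x.2
  conv_rhs => rw [P.as_sum, map_sum]
  rw [redPoly, support_map_of_injective _ Subtype.val_injective]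
  refine Finset.sum_congr rfl fun m _ => ?_
  rw [coeff_map, hred, map_monomial]

theorem norm_coeff_map_subtype_le (P : MvPolynomial (Fin 2) (intRing E)) (m : Fin 2 →₀ ℕ) :
    ‖(map (intRing E).subtype P).coeff m‖ ≤ 1 := by
  rw [coeff_map]
  exact (P.coeff m).2

theorem map_residueHom_eq_zero {P : MvPolynomial (Fin 2) (intRing E)}
    (h : ∀ m, ‖(map (intRing E).subtype P).coeff m‖ ≠ 1) : map (residueHom E) P = 0 := by
  ext m
  rw [coeff_map, coeff_zero, residueHom_eq_zero_iff]
  have := (norm_coeff_map_subtype_le P m).lt_of_ne (h m)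
  rwa [coeff_map] at this

end Reduction

/-- If `[F,G]` is a normalized lift of a degree-`d ≥ 2` rational map `φ` over a
complete algebraically closed non-Archimedean field `K`, and the reduction `φ_v ∉ I(d)`, then for
every `n ≥ 1` the iterated lift `[F_n, G_n]` is itself a normalized lift of `φⁿ`; in particular
its coefficientwise reduction modulo `m` is not identically zero, and it equals the `n`-fold
iteration of the reduced pair `[F̃, G̃]`. -/
theorem iterated_lift_normalized {K : Type} [NontriviallyNormedField K] [IsAlgClosed K]
    [CompleteSpace K] [IsUltrametricDist K] (d : ℕ) (hd : 2 ≤ d)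
    (F G : MvPolynomial (Fin 2) K) (hlift : LiftPair K d F G) (hnorm : Normalized K F G)
    (hI : ¬ Ilocus K d F G) (n : ℕ) (hn : 1 ≤ n) :
    LiftPair K (d ^ n) (pairIter F G n).1 (pairIter F G n).2 ∧
    Normalized K (pairIter F G n).1 (pairIter F G n).2 ∧
    ¬(redPoly K (pairIter F G n).1 = 0 ∧ redPoly K (pairIter F G n).2 = 0) ∧
    redPoly K (pairIter F G n).1 = (pairIter (redPoly K F) (redPoly K G) n).1 ∧
    redPoly K (pairIter F G n).2 = (pairIter (redPoly K F) (redPoly K G) n).2 := by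
  obtain ⟨hF, hG, hFG⟩ := hlift
  obtain ⟨P, rfl⟩ := exists_map_subtype_eq hnorm.1
  obtain ⟨Q, rfl⟩ := exists_map_subtype_eq hnorm.2.1
  have hinj : Function.Injective (intRing K).subtype := Subtype.val_injective
  have hP : P.IsHomogeneous d := hF.of_map hinj
  have hQ : Q.IsHomogeneous d := hG.of_map hinj
  have hit := map_pairIter (intRing K).subtype P Q n
  have hitred := map_pairIter (residueHom K) P Q n
  have hne : ¬(map (residueHom K) (pairIter P Q n).1 = 0 ∧
      map (residueHom K) (pairIter P Q n).2 = 0) := by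
    rw [hitred.1, hitred.2]
    refine pairIter_ne_zero (hP.map _) (hQ.map _) (fun a b H hab hH h1 h2 h0 => ?_) n
    refine hI ⟨a, b, H, hab, hH, ?_, ?_, h0⟩
    · rw [redPoly_map_subtype]; exact h1
    · rw [redPoly_map_subtype]; exact h2
  have hhom := isHomogeneous_pairIter hF hG n
  refine ⟨⟨hhom.1, hhom.2, isRelPrime_pairIter hF hG hFG n⟩, ?_⟩
  simp only [← hit.1, ← hit.2, redPoly_map_subtype, ← hitred.1, ← hitred.2, and_self, and_true]
  refine ⟨⟨norm_coeff_map_subtype_le _, norm_coeff_map_subtype_le _, ?_⟩, hne⟩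
  by_contra! hcon
  exact hne ⟨map_residueHom_eq_zero fun m => (hcon m).1,
    map_residueHom_eq_zero fun m => (hcon m).2⟩

end
end

section
/- Let φ ∈ K(z) have degree d ≥ 2. Then for every n ≥ 1 one has the inequality R_{φⁿ} ≤ N_n · R_φ, where N_n = dⁿ(dⁿ−1)/(d(d−1)). Equivalently, for a normalized lift [F,G] of φ with iterated lift [F_n, G_n], one has ord(Res(F_n,G_n)) − 2dⁿ·min(ord of the coefficients of F_n and G_n) ≤ N_n · ord(Res(F,G)). -/
open MvPolynomial Matrix

noncomputable section

variable {R : Type*} [CommRing R]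

variable (K : Type) [NontriviallyNormedField K] [IsUltrametricDist K]

theorem bres_homogenize (e : ℕ) (p q : Polynomial R) :
    bres e (p.homogenize e) (q.homogenize e) = Polynomial.resultant p q e e := by
  rw [bres, Polynomial.resultant, ← Matrix.det_submatrix_equiv_self Fin.revPerm,
    ← Matrix.det_transpose]
  congr 1
  ext i j
  have hi := i.isLt
  have hc (p : Polynomial R) (k : Fin (e + 1)) :
      coeffVec e (p.homogenize e) k = p.coeff (e - k) := by
    have hk := k.isLt
    have : e - (k : ℕ) + k = e := by omega
    simp [coeffVec, Polynomial.coeff_homogenize, this]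
  simp only [Matrix.transpose_apply, Matrix.submatrix_apply, Fin.revPerm_apply, sylv,
    Polynomial.sylvester, Matrix.of_apply, Fin.val_rev, hc]
  refine Fin.addCases (fun k => ?_) (fun k => ?_) j
  · have hk := k.isLt
    simp only [Fin.val_castAdd, Fin.addCases_left, Set.mem_Icc]
    rw [dif_neg (by omega)]
    split_ifs with h₁ h₂ h₂
    · congr 1; omega
    · omega
    · omega
    · rfl
  · have hk := k.isLt
    simp only [Fin.val_natAdd, Fin.addCases_right, Set.mem_Icc]
    rw [dif_pos (by omega)]
    split_ifs with h₁ h₂ h₂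
    · congr 1; omega
    · omega
    · omega
    · rfl

theorem homogenize_dehomogenize {e : ℕ} {F : MvPolynomial (Fin 2) R} (hF : F.IsHomogeneous e) :
    (MvPolynomial.aeval ![Polynomial.X, 1] F : Polynomial R).homogenize e = F :=
  Polynomial.homogenize_eq_of_isHomogeneous hF rfl

theorem natDegree_dehomogenize_le {e : ℕ} {F : MvPolynomial (Fin 2) R} (hF : F.IsHomogeneous e) :
    (MvPolynomial.aeval ![Polynomial.X, 1] F : Polynomial R).natDegree ≤ e := by
  rw [Polynomial.natDegree_le_iff_coeff_eq_zero]
  intro N hN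
  rw [F.as_sum, map_sum, Polynomial.finsetSum_coeff]
  refine Finset.sum_eq_zero fun m hm => ?_
  have hm' : m 0 + m 1 = e := by
    have := hF (by simpa using hm)
    simpa [Finsupp.weight_apply, Finsupp.sum_fintype, Fin.sum_univ_two] using this
  simp [MvPolynomial.aeval_monomial, Finsupp.prod_fintype, Fin.prod_univ_two,
    Polynomial.coeff_X_pow]
  omega

theorem bres_eq_resultant {e : ℕ} {F G : MvPolynomial (Fin 2) R} (hF : F.IsHomogeneous e)
    (hG : G.IsHomogeneous e) :
    bres e F G = Polynomial.resultant (MvPolynomial.aeval ![Polynomial.X, 1] F)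
      (MvPolynomial.aeval ![Polynomial.X, 1] G) e e := by
  rw [← bres_homogenize, homogenize_dehomogenize hF, homogenize_dehomogenize hG]

theorem resultant_mul_left_of_le (f₁ f₂ g : Polynomial R) {m₁ m₂ n : ℕ}
    (h₁ : f₁.natDegree ≤ m₁) (h₂ : f₂.natDegree ≤ m₂) (hg : g.natDegree ≤ n) :
    Polynomial.resultant (f₁ * f₂) g (m₁ + m₂) n =
      Polynomial.resultant f₁ g m₁ n * Polynomial.resultant f₂ g m₂ n := by
  obtain ⟨k₁, rfl⟩ := Nat.exists_eq_add_of_le h₁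
  obtain ⟨k₂, rfl⟩ := Nat.exists_eq_add_of_le h₂
  rw [add_add_add_comm, Polynomial.resultant_add_left_deg _ _ _ _ _ Polynomial.natDegree_mul_le,
    Polynomial.resultant_mul_left _ _ _ _ hg, Polynomial.resultant_add_left_deg _ _ _ _ _ le_rfl,
    Polynomial.resultant_add_left_deg _ _ _ _ _ le_rfl]
  ring

theorem resultant_prod_left_of_le {ι : Type*} (s : Finset ι) (f : ι → Polynomial R)
    (g : Polynomial R) {m n : ℕ} (hf : ∀ i ∈ s, (f i).natDegree ≤ m) (hg : g.natDegree ≤ n) :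
    Polynomial.resultant (∏ i ∈ s, f i) g (s.card * m) n =
      ∏ i ∈ s, Polynomial.resultant (f i) g m n := by
  induction s using Finset.cons_induction with
  | empty => simp
  | cons a s ha ih =>
    rw [Finset.forall_mem_cons] at hf
    rw [Finset.prod_cons, Finset.prod_cons, Finset.card_cons, add_comm, add_mul, one_mul,
      resultant_mul_left_of_le _ _ _ hf.1 _ hg, ih hf.2]
    exact (Polynomial.natDegree_prod_le _ _).trans
      (by simpa using Finset.sum_le_card_nsmul _ _ _ hf.2)

theorem resultant_prod_right_of_le {ι : Type*} (s : Finset ι) (f : Polynomial R)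
    (g : ι → Polynomial R) {m n : ℕ} (hf : f.natDegree ≤ m) (hg : ∀ i ∈ s, (g i).natDegree ≤ n) :
    Polynomial.resultant f (∏ i ∈ s, g i) m (s.card * n) =
      ∏ i ∈ s, Polynomial.resultant f (g i) m n := by
  rw [Polynomial.resultant_comm, resultant_prod_left_of_le s g f hg hf]
  simp_rw [Polynomial.resultant_comm f]
  rw [Finset.prod_mul_distrib, Finset.prod_const, ← pow_mul]
  ring_nf

section Field

variable {k : Type*} [Field k]

open Polynomial in
theorem resultant_linear_combination (f g : k[X]) (a b c d : k) {e : ℕ} (hf : f.natDegree ≤ e)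
    (hg : g.natDegree ≤ e) :
    resultant (Polynomial.C a * f + Polynomial.C b * g) (Polynomial.C c * f + Polynomial.C d * g) e e =
      (a * d - b * c) ^ e * resultant f g e e := by
  have hlc (r s : k) : (Polynomial.C r * f + Polynomial.C s * g).natDegree ≤ e :=
    natDegree_add_le_of_degree_le ((natDegree_C_mul_le _ _).trans hf)
      ((natDegree_C_mul_le _ _).trans hg)
  by_cases ha : a = 0
  · subst ha
    have h := resultant_add_mul_right g (Polynomial.C c * f) (Polynomial.C d) e e (by simp) hg
    rw [mul_comm g] at h
    rw [Polynomial.C_0, zero_mul, zero_add, resultant_C_mul_left, h, resultant_C_mul_right,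
      resultant_comm g f]
    rcases Nat.even_or_odd e with he | he
    · rw [(he.mul_right e).neg_one_pow, zero_mul, zero_sub, he.neg_pow, mul_pow]
      ring
    · rw [(he.mul he).neg_one_pow, zero_mul, zero_sub, he.neg_pow, mul_pow]
      ring
  · have h₁ := resultant_add_mul_right (Polynomial.C a * f + Polynomial.C b * g)
      (Polynomial.C (d - b * (c / a)) * g) (Polynomial.C (c / a)) e e (by simp) (hlc a b)
    have h₂ : Polynomial.C (d - b * (c / a)) * g +
        (Polynomial.C a * f + Polynomial.C b * g) * Polynomial.C (c / a) =
          Polynomial.C c * f + Polynomial.C d * g := by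
      have : Polynomial.C c = Polynomial.C a * Polynomial.C (c / a) := by
        rw [← Polynomial.C_mul]; congr 1; field_simp
      simp only [Polynomial.C_sub, Polynomial.C_mul, this]
      ring
    have h₃ := resultant_add_mul_left (Polynomial.C a * f) g (Polynomial.C b) e e (by simp) hg
    rw [mul_comm g] at h₃
    rw [← h₂, h₁, resultant_C_mul_right, h₃, resultant_C_mul_left, ← mul_assoc, ← mul_pow]
    congr 2
    field_simp

open Polynomial in
theorem exists_eq_prod_linear [IsAlgClosed k] (n : ℕ) (p : k[X]) (hp : p.natDegree ≤ n + 1) :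
    ∃ a b : Fin (n + 1) → k, p = ∏ i, (Polynomial.C (a i) * Polynomial.X + Polynomial.C (b i)) := by
  induction n generalizing p with
  | zero =>
    obtain ⟨a, b, h⟩ := exists_eq_X_add_C_of_natDegree_le_one hp
    exact ⟨fun _ => a, fun _ => b, by simpa using h⟩
  | succ n ih =>
    obtain ⟨a, b, q, hq, h⟩ : ∃ (a b : k) (q : k[X]), q.natDegree ≤ n + 1 ∧
        p = (Polynomial.C a * Polynomial.X + Polynomial.C b) * q := by
      by_cases h0 : p.natDegree = 0
      · exact ⟨0, 1, p, by omega, by simp⟩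
      · obtain ⟨r, hr⟩ := IsAlgClosed.exists_root p fun h => h0 (natDegree_eq_of_degree_eq_some h)
        obtain ⟨q, rfl⟩ := dvd_iff_isRoot.mpr hr
        refine ⟨1, -r, q, ?_, by simp [sub_eq_add_neg]⟩
        have hq : q ≠ 0 := by rintro rfl; simp at h0
        rw [natDegree_mul (X_sub_C_ne_zero r) hq, natDegree_X_sub_C] at hp
        omega
    obtain ⟨a', b', rfl⟩ := ih q hq
    exact ⟨Fin.cons a a', Fin.cons b b', by simp [h, Fin.prod_univ_succ (n := n + 1)]⟩

/-- A binary form of positive degree over an algebraically closed field is a product of linear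
forms. -/
theorem exists_aeval_eq_prod_linear [IsAlgClosed k] {d : ℕ} (hd : d ≠ 0)
    {F : MvPolynomial (Fin 2) k} (hF : F.IsHomogeneous d) :
    ∃ a b : Fin d → k, ∀ u v : Polynomial k, MvPolynomial.aeval ![u, v] F =
      ∏ i, (Polynomial.C (a i) * u + Polynomial.C (b i) * v) := by
  obtain ⟨n, rfl⟩ := Nat.exists_eq_succ_of_ne_zero hd
  obtain ⟨a, b, h⟩ := exists_eq_prod_linear n _ (natDegree_dehomogenize_le hF)
  refine ⟨a, b, fun u v => ?_⟩
  have hprod := Polynomial.homogenize_finsetProd (s := Finset.univ)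
    (p := fun i => Polynomial.C (a i) * Polynomial.X + Polynomial.C (b i)) (n := fun _ => 1)
    fun i _ => Polynomial.natDegree_linear_le
  rw [← h, Finset.sum_const, Finset.card_fin, smul_eq_mul, mul_one,
    homogenize_dehomogenize hF] at hprod
  rw [hprod, map_prod]
  simp

theorem exists_resultant_aeval [IsAlgClosed k] {d : ℕ} (hd : d ≠ 0) {F G : MvPolynomial (Fin 2) k}
    (hF : F.IsHomogeneous d) (hG : G.IsHomogeneous d) :
    ∃ Δ : k, ∀ (e : ℕ) (u v : Polynomial k), u.natDegree ≤ e → v.natDegree ≤ e →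
      Polynomial.resultant (MvPolynomial.aeval ![u, v] F) (MvPolynomial.aeval ![u, v] G)
        (d * e) (d * e) = Δ ^ e * Polynomial.resultant u v e e ^ (d * d) := by
  obtain ⟨a, b, hab⟩ := exists_aeval_eq_prod_linear hd hF
  obtain ⟨a', b', hab'⟩ := exists_aeval_eq_prod_linear hd hG
  refine ⟨∏ i, ∏ j, (a i * b' j - b i * a' j), fun e u v hu hv => ?_⟩
  have hlc (r s : k) : (Polynomial.C r * u + Polynomial.C s * v).natDegree ≤ e :=
    Polynomial.natDegree_add_le_of_degree_le ((Polynomial.natDegree_C_mul_le _ _).trans hu)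
      ((Polynomial.natDegree_C_mul_le _ _).trans hv)
  have hG' : (MvPolynomial.aeval ![u, v] G : Polynomial k).natDegree ≤ d * e := by
    rw [hab']
    exact (Polynomial.natDegree_prod_le _ _).trans
      (by simpa using Finset.sum_le_card_nsmul Finset.univ _ _ fun i _ => hlc (a' i) (b' i))
  have h₁ := resultant_prod_left_of_le Finset.univ
    (fun i => Polynomial.C (a i) * u + Polynomial.C (b i) * v) _ (fun i _ => hlc (a i) (b i)) hG'
  have h₂ (i : Fin d) := resultant_prod_right_of_le Finset.univ
    (Polynomial.C (a i) * u + Polynomial.C (b i) * v)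
    (fun j => Polynomial.C (a' j) * u + Polynomial.C (b' j) * v) (hlc (a i) (b i))
    (fun j _ => hlc (a' j) (b' j))
  rw [Finset.card_fin] at h₁ h₂
  rw [hab, h₁, hab']
  simp_rw [h₂, resultant_linear_combination _ _ _ _ _ _ hu hv, Finset.prod_mul_distrib,
    Finset.prod_const, Finset.card_fin, Finset.prod_pow, ← pow_mul]

theorem comp2_isHomogeneous {d e : ℕ} {F f g : MvPolynomial (Fin 2) R} (hF : F.IsHomogeneous d)
    (hf : f.IsHomogeneous e) (hg : g.IsHomogeneous e) : (comp2 F f g).IsHomogeneous (d * e) := by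
  rw [mul_comm]
  exact hF.aeval _ fun i => by fin_cases i <;> assumption

theorem aeval_comp2 {A : Type*} [CommRing A] [Algebra R A] (x : Fin 2 → A)
    (F f g : MvPolynomial (Fin 2) R) :
    MvPolynomial.aeval x (comp2 F f g) =
      MvPolynomial.aeval ![MvPolynomial.aeval x f, MvPolynomial.aeval x g] F := by
  rw [comp2, ← AlgHom.comp_apply, MvPolynomial.comp_aeval]
  congr 2
  ext i
  fin_cases i <;> rfl

/-- The composition law for resultants of binary forms. -/
theorem bres_comp2 [IsAlgClosed k] {d e : ℕ} (hd : d ≠ 0) {F G f g : MvPolynomial (Fin 2) k}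
    (hF : F.IsHomogeneous d) (hG : G.IsHomogeneous d) (hf : f.IsHomogeneous e)
    (hg : g.IsHomogeneous e) :
    bres (d * e) (comp2 F f g) (comp2 G f g) = bres d F G ^ e * bres e f g ^ (d * d) := by
  obtain ⟨Δ, hΔ⟩ := exists_resultant_aeval hd hF hG
  have h₁ : bres d F G = Δ := by
    simpa [bres_eq_resultant hF hG] using hΔ 1 Polynomial.X 1 Polynomial.natDegree_X_le (by simp)
  rw [bres_eq_resultant (comp2_isHomogeneous hF hf hg) (comp2_isHomogeneous hG hf hg),
    aeval_comp2, aeval_comp2, hΔ e _ _ (natDegree_dehomogenize_le hf)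
    (natDegree_dehomogenize_le hg), h₁, bres_eq_resultant hf hg]

theorem pairIter_isHomogeneous {d : ℕ} {F G : MvPolynomial (Fin 2) R} (hF : F.IsHomogeneous d)
    (hG : G.IsHomogeneous d) (n : ℕ) :
    (pairIter F G n).1.IsHomogeneous (d ^ n) ∧ (pairIter F G n).2.IsHomogeneous (d ^ n) := by
  induction n with
  | zero => exact ⟨MvPolynomial.isHomogeneous_X _ _, MvPolynomial.isHomogeneous_X _ _⟩
  | succ n ih =>
    rw [pow_succ']
    exact ⟨comp2_isHomogeneous hF ih.1 ih.2, comp2_isHomogeneous hG ih.1 ih.2⟩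

theorem exists_bres_pairIter_eq_pow [IsAlgClosed k] {d : ℕ} (hd : d ≠ 0)
    {F G : MvPolynomial (Fin 2) k} (hF : F.IsHomogeneous d) (hG : G.IsHomogeneous d) (n : ℕ) :
    ∃ c : ℕ, bres (d ^ n) (pairIter F G n).1 (pairIter F G n).2 = bres d F G ^ c ∧
      (c : ℝ) * (d * (d - 1)) = d ^ n * (d ^ n - 1) := by
  induction n with
  | zero =>
    refine ⟨0, ?_, by simp⟩
    rw [pow_zero, pow_zero]
    exact (bres_eq_resultant (MvPolynomial.isHomogeneous_X _ _)
      (MvPolynomial.isHomogeneous_X _ _)).trans (by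
        rw [MvPolynomial.aeval_X, MvPolynomial.aeval_X]; simp)
  | succ n ih =>
    obtain ⟨c, hc, hc'⟩ := ih
    obtain ⟨h₁, h₂⟩ := pairIter_isHomogeneous hF hG n
    refine ⟨d ^ n + c * (d * d), ?_, ?_⟩
    · rw [pow_succ', pow_add, pow_mul, ← hc]
      exact bres_comp2 hd hF hG h₁ h₂
    · push_cast
      linear_combination (d : ℝ) ^ 2 * hc'

end Field

section Integral

variable {L : Type} [NontriviallyNormedField L]

theorem comp2_mem_range_map {S : Type*} [CommRing S] (φ : S →+* R) {F f g : MvPolynomial (Fin 2) R}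
    (hF : F ∈ (MvPolynomial.map (σ := Fin 2) φ).range)
    (hf : f ∈ (MvPolynomial.map (σ := Fin 2) φ).range)
    (hg : g ∈ (MvPolynomial.map (σ := Fin 2) φ).range) :
    comp2 F f g ∈ (MvPolynomial.map (σ := Fin 2) φ).range := by
  obtain ⟨F, rfl⟩ := hF
  obtain ⟨f, rfl⟩ := hf
  obtain ⟨g, rfl⟩ := hg
  refine ⟨comp2 F f g, ?_⟩
  rw [comp2, comp2, MvPolynomial.aeval_def, MvPolynomial.aeval_def, MvPolynomial.eval₂_map,
    MvPolynomial.hom_eval₂]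
  congr 1
  · ext x
    simp
  · ext i
    fin_cases i <;> rfl

theorem pairIter_mem_range_map {S : Type*} [CommRing S] (φ : S →+* R)
    {F G : MvPolynomial (Fin 2) R} (hF : F ∈ (MvPolynomial.map (σ := Fin 2) φ).range)
    (hG : G ∈ (MvPolynomial.map (σ := Fin 2) φ).range) (n : ℕ) :
    (pairIter F G n).1 ∈ (MvPolynomial.map (σ := Fin 2) φ).range ∧
      (pairIter F G n).2 ∈ (MvPolynomial.map (σ := Fin 2) φ).range := by
  induction n with
  | zero => exact ⟨⟨X 0, MvPolynomial.map_X _ _⟩, ⟨X 1, MvPolynomial.map_X _ _⟩⟩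
  | succ n ih => exact ⟨comp2_mem_range_map φ hF ih.1 ih.2, comp2_mem_range_map φ hG ih.1 ih.2⟩

theorem mem_range_map_intRing_iff [IsUltrametricDist L] {F : MvPolynomial (Fin 2) L} :
    F ∈ (MvPolynomial.map (σ := Fin 2) (intRing L).subtype).range ↔ ∀ m, ‖F.coeff m‖ ≤ 1 := by
  refine ⟨?_, fun h => ?_⟩
  · rintro ⟨F, rfl⟩ m
    rw [MvPolynomial.coeff_map]
    exact (F.coeff m).2
  · rw [RingHom.mem_range, ← Set.mem_range, MvPolynomial.mem_range_map_iff_coeffs_subset]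
    intro x hx
    obtain ⟨m, -, rfl⟩ := MvPolynomial.mem_coeffs_iff.mp hx
    exact ⟨⟨F.coeff m, h m⟩, rfl⟩

theorem log_maxNorm_nonpos (e : ℕ) {F G : MvPolynomial (Fin 2) L} (hF : ∀ m, ‖F.coeff m‖ ≤ 1)
    (hG : ∀ m, ‖G.coeff m‖ ≤ 1) : Real.log (maxNorm L e F G) ≤ 0 := by
  refine Real.log_nonpos ?_ (Finset.sup'_le _ _ fun i _ => max_le (hF _) (hG _))
  exact Finset.le_sup'_of_le _ (Finset.mem_univ 0) ((norm_nonneg _).trans (le_max_left _ _))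

theorem maxNorm_eq_one {e : ℕ} {F G : MvPolynomial (Fin 2) L} (hF : F.IsHomogeneous e)
    (hG : G.IsHomogeneous e) (h : Normalized L F G) : maxNorm L e F G = 1 := by
  obtain ⟨h₁, h₂, m, hm⟩ := h
  refine le_antisymm (Finset.sup'_le _ _ fun i _ => max_le (h₁ _) (h₂ _)) ?_
  have hdeg : m 0 + m 1 = e := by
    have : m.weight 1 = e := by
      rcases hm with hm | hm
      · exact hF fun h0 => by simp [h0] at hm
      · exact hG fun h0 => by simp [h0] at hm
    simpa [Finsupp.weight_apply, Finsupp.sum_fintype, Fin.sum_univ_two] using this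
  have hm' : Finsupp.single 0 (e - m 1) + Finsupp.single 1 (m 1) = m := by
    ext i
    fin_cases i <;> simp; omega
  refine le_trans ?_ (Finset.le_sup' _ (Finset.mem_univ ⟨m 1, by omega⟩))
  simp only [coeffVec, hm', le_max_iff]
  exact hm.imp Eq.ge Eq.ge

end Integral

/-- For a degree-`d ≥ 2` rational map `φ` with normalized lift `[F,G]` and
iterated lift `[F_n, G_n]`, one has `R_{φⁿ} ≤ N_n · R_φ` for every `n ≥ 1`, where
`N_n = dⁿ(dⁿ−1)/(d(d−1))`; here `R_{φⁿ}` is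
`ord(Res(F_n,G_n)) − 2dⁿ·min(ord of the coefficients of F_n and G_n)`,
which is what `Rpair` computes. -/
theorem resultant_iterate_le {K : Type} [NontriviallyNormedField K]
    [IsAlgClosed K] [CompleteSpace K] [IsUltrametricDist K] (d : ℕ) (hd : 2 ≤ d)
    (F G : MvPolynomial (Fin 2) K) (hlift : LiftPair K d F G) (hnorm : Normalized K F G) :
    ∀ n : ℕ, 1 ≤ n →
      Rpair K (d ^ n) (pairIter F G n).1 (pairIter F G n).2 ≤
        ((d : ℝ) ^ n * ((d : ℝ) ^ n - 1) / ((d : ℝ) * ((d : ℝ) - 1))) * Rpair K d F G := by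
  intro n _
  obtain ⟨hF, hG, -⟩ := hlift
  obtain ⟨c, hc, hc'⟩ := exists_bres_pairIter_eq_pow (by omega) hF hG n
  obtain ⟨h₁, h₂⟩ := pairIter_mem_range_map (intRing K).subtype
    (mem_range_map_intRing_iff.mpr hnorm.1) (mem_range_map_intRing_iff.mpr hnorm.2.1) n
  have hlog := log_maxNorm_nonpos (d ^ n) (mem_range_map_intRing_iff.mp h₁)
    (mem_range_map_intRing_iff.mp h₂)
  have hd' : (2 : ℝ) ≤ d := by exact_mod_cast hd
  have hpos : (0 : ℝ) < d * (d - 1) := by apply mul_pos <;> linarith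
  rw [← (eq_div_iff hpos.ne').mpr hc', Rpair, Rpair, maxNorm_eq_one hF hG hnorm, hc, ordv, ordv,
    norm_pow, Real.log_pow, Real.log_one, mul_zero, add_zero, mul_neg]
  exact add_le_of_nonpos_right (mul_nonpos_of_nonneg_of_nonpos (by positivity) hlog)

end
end
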